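/- Let λ_n = √(8(2n+1)² + 9)/4 for n ∈ ℕ. There exists a function Z : ℂ → ℂ with the following properties: (i) Z is complex differentiable at every point of ℂ \ { 1 − 2l : l ∈ ℕ }; (ii) for every s ∈ ℂ with Re s > 1, Z(s) = ∑_{n=0}^∞ λ_n^{−s}; (iii) for every l ∈ ℕ, (s − (1−2l))·Z(s) tends, as s → 1−2l (along s ≠ 1−2l), to (1/√2)·C(2l, l)·(9/64)^l; (iv) Z(−2l) = 0 for every l ∈ ℕ (in particular Z(0) = 0). -/

import Mathlib

open Real Filter Topology

/-- The eigenvalue parameters `λ_n = √(8(2n+1)² + 9)/4`. -/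
noncomputable def lam (n : ℕ) : ℝ := Real.sqrt (8 * (2 * n + 1) ^ 2 + 9) / 4

section RingChoose

theorem Ring.choose_succ_mul_succ (z : ℂ) (k : ℕ) :
    Ring.choose z (k + 1) * (k + 1) = Ring.choose z k * (z - k) := by
  have h := Ring.choose_smul_choose z (Nat.le_succ k)
  simp only [Nat.succ_eq_add_one, Nat.choose_succ_self_right, nsmul_eq_mul, Nat.cast_add,
    Nat.cast_one, Nat.add_sub_cancel_left, Ring.choose_one_right] at h
  rw [mul_comm, h]

theorem Ring.differentiable_choose (k : ℕ) :
    Differentiable ℂ fun z : ℂ => Ring.choose z k := by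
  induction k with
  | zero => simp
  | succ k ih =>
    have h : (fun z : ℂ => Ring.choose z (k + 1)) =
        fun z : ℂ => Ring.choose z k * (z - k) / (k + 1) := by
      ext z
      rw [← Ring.choose_succ_mul_succ, mul_div_cancel_right₀ _ (Nat.cast_add_one_ne_zero k)]
    rw [h]
    fun_prop

theorem Ring.norm_choose_le {z : ℂ} {R : ℕ} (hR : 1 ≤ R) (hz : ‖z‖ ≤ R) (k : ℕ) :
    ‖Ring.choose z k‖ ≤ 2 ^ (R + k) := by
  suffices h : ‖Ring.choose z k‖ ≤ ((R + k - 1).choose k : ℝ) by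
    refine h.trans ?_
    calc ((R + k - 1).choose k : ℝ) ≤ 2 ^ (R + k - 1) := by
          exact_mod_cast Nat.choose_le_two_pow _ _
      _ ≤ 2 ^ (R + k) := pow_le_pow_right₀ one_le_two (Nat.sub_le _ _)
  induction k with
  | zero => simp
  | succ k ih =>
    have hpos : (0 : ℝ) < k + 1 := by positivity
    have hnorm : ‖(k : ℂ) + 1‖ = k + 1 := by
      rw [← Nat.cast_add_one, Complex.norm_natCast, Nat.cast_add_one]
    have h1 := congrArg norm (Ring.choose_succ_mul_succ z k)
    rw [norm_mul, norm_mul, hnorm] at h1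
    have h2 : ‖z - k‖ ≤ R + k := (norm_sub_le _ _).trans (by simpa using hz)
    obtain ⟨m, rfl⟩ : ∃ m, R = m + 1 := ⟨R - 1, by omega⟩
    have h3 : ((m + 1 + (k + 1) - 1).choose (k + 1) : ℝ) * (k + 1)
        = ((m + 1 + k - 1).choose k : ℝ) * ((m + 1 : ℕ) + k) := by
      have := Nat.add_one_mul_choose_eq (m + k) k
      rw [show m + 1 + (k + 1) - 1 = m + k + 1 by omega, show m + 1 + k - 1 = m + k by omega]
      rw [mul_comm (m + k + 1)] at this
      have h4 := congrArg (Nat.cast (R := ℝ)) this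
      push_cast at h4 ⊢
      linarith
    refine le_of_mul_le_mul_right ?_ hpos
    rw [h1, h3]
    gcongr

theorem Ring.choose_sub_half (l : ℕ) :
    Ring.choose ((l : ℂ) - 1 / 2) l = ((2 * l).choose l : ℂ) / 4 ^ l := by
  rw [← Nat.centralBinom_eq_two_mul_choose]
  induction l with
  | zero => simp
  | succ l ih =>
    have h := Ring.choose_add_smul_choose ((l : ℂ) - 1 / 2) l 1
    simp only [Nat.choose_one_right, nsmul_eq_mul, Ring.choose_one_right, ih] at h
    have hc := congrArg (Nat.cast (R := ℂ)) (Nat.succ_mul_centralBinom_succ l)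
    have hl : (l : ℂ) + 1 ≠ 0 := Nat.cast_add_one_ne_zero l
    push_cast at h hc ⊢
    rw [show (l : ℂ) + 1 - 1 / 2 = l - 1 / 2 + 1 by ring]
    refine mul_left_cancel₀ hl ?_
    rw [h, mul_div_assoc', mul_div_assoc', hc]
    field_simp
    ring

theorem Complex.hasSum_choose_mul_pow (z : ℂ) {y : ℂ} (hy : ‖y‖ < 1) :
    HasSum (fun k => Ring.choose z k * y ^ k) ((1 + y) ^ z) := by
  have h := (Complex.one_add_cpow_hasFPowerSeriesOnBall_zero (a := z)).hasSum (y := y)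
    (by rw [← ENNReal.ofReal_one, Metric.eball_ofReal]; simpa using hy)
  simpa [binomialSeries, mul_comm] using h

end RingChoose

section HalfIntegerZeta

open HurwitzZeta

/-- The continuation of `∑_{n ≥ 1} (n + 1/2)^{-w}`. -/
noncomputable def halfTailZeta (w : ℂ) : ℂ :=
  hurwitzZeta ((1 / 2 : ℝ) : UnitAddCircle) w - ((1 / 2 : ℝ) : ℂ) ^ (-w)

theorem differentiable_half_cpow_neg :
    Differentiable ℂ fun w : ℂ => ((1 / 2 : ℝ) : ℂ) ^ (-w) :=
  fun w => (differentiableAt_id.neg).const_cpow (Or.inl (by norm_num))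

theorem differentiableAt_halfTailZeta {w : ℂ} (hw : w ≠ 1) :
    DifferentiableAt ℂ halfTailZeta w :=
  (differentiableAt_hurwitzZeta _ hw).sub (differentiable_half_cpow_neg w)

theorem halfTailZeta_residue_one :
    Tendsto (fun w => (w - 1) * halfTailZeta w) (𝓝[≠] 1) (𝓝 1) := by
  have h : Tendsto (fun w : ℂ => (w - 1) * ((1 / 2 : ℝ) : ℂ) ^ (-w)) (𝓝[≠] 1)
      (𝓝 ((1 - 1) * ((1 / 2 : ℝ) : ℂ) ^ (-1 : ℂ))) :=
    (((continuous_id.sub continuous_const).mul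
      differentiable_half_cpow_neg.continuous).tendsto 1).mono_left nhdsWithin_le_nhds
  simpa [halfTailZeta, mul_sub] using
    (hurwitzZeta_residue_one ((1 / 2 : ℝ) : UnitAddCircle)).sub h

theorem hasSum_halfTailZeta {w : ℂ} (hw : 1 < w.re) :
    HasSum (fun n : ℕ => ((n + 3 / 2 : ℝ) : ℂ) ^ (-w)) (halfTailZeta w) := by
  have h := hasSum_hurwitzZeta_of_one_lt_re (a := 1 / 2) (by norm_num) hw
  have h' := (hasSum_nat_add_iff' 1).mpr h
  convert! h' using 1
  · ext n
    rw [Complex.cpow_neg, one_div]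
    push_cast
    ring_nf
  · simp [halfTailZeta, Complex.cpow_neg]

theorem exists_norm_halfTailZeta_le :
    ∃ C : ℝ, 0 ≤ C ∧ ∀ w : ℂ, 2 ≤ w.re → ‖halfTailZeta w‖ ≤ C * (2 / 3 : ℝ) ^ w.re := by
  have hs : Summable fun n : ℕ => (n + 3 / 2 : ℝ) ^ (-2 : ℝ) := by
    have h := (hasSum_halfTailZeta (w := 2) (by norm_num)).summable.norm
    refine h.congr fun n => ?_
    rw [Complex.norm_cpow_eq_rpow_re_of_pos (by positivity)]
    simp
  refine ⟨(∑' n : ℕ, (n + 3 / 2 : ℝ) ^ (-2 : ℝ)) * (2 / 3) ^ (-2 : ℝ),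
    mul_nonneg (tsum_nonneg fun n => by positivity) (by positivity), fun w hw => ?_⟩
  rw [← (hasSum_halfTailZeta (by linarith)).tsum_eq, mul_assoc, ← tsum_mul_right]
  refine tsum_of_norm_bounded (hs.mul_right _).hasSum fun n => ?_
  rw [Complex.norm_cpow_eq_rpow_re_of_pos (by positivity), ← Real.rpow_add (by norm_num),
    Complex.neg_re, show -w.re = -2 + -(-2 + w.re) by ring, Real.rpow_add (by positivity)]
  gcongr
  rw [show (2 / 3 : ℝ) = (3 / 2)⁻¹ by norm_num, Real.inv_rpow (by norm_num),
    ← Real.rpow_neg (by norm_num)]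
  exact Real.rpow_le_rpow_of_nonpos (by norm_num) (by simp) (by linarith)

theorem hurwitzZeta_half_neg_two_mul (m : ℕ) :
    hurwitzZeta ((1 / 2 : ℝ) : UnitAddCircle) (-(2 * m)) = 0 := by
  have hneg : -((1 / 2 : ℝ) : UnitAddCircle) = ((1 / 2 : ℝ) : UnitAddCircle) := by
    rw [← AddCircle.coe_neg, ← sub_eq_zero, ← AddCircle.coe_sub]
    norm_num [AddCircle.coe_eq_zero_iff]
  have hodd (s : ℂ) : hurwitzZetaOdd ((1 / 2 : ℝ) : UnitAddCircle) s = 0 := by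
    have := hurwitzZetaOdd_neg ((1 / 2 : ℝ) : UnitAddCircle) s
    rw [hneg] at this
    exact self_eq_neg.mp this
  rw [hurwitzZeta, hodd, add_zero]
  cases m with
  | zero =>
    have h0 : ((1 / 2 : ℝ) : UnitAddCircle) ≠ 0 := by
      rw [Ne, AddCircle.coe_eq_zero_iff]
      rintro ⟨n, hn⟩
      have : (2 * n : ℝ) = 1 := by
        simp only [zsmul_eq_mul, mul_one] at hn
        linarith
      have : 2 * n = 1 := by exact_mod_cast this
      omega
    rw [Nat.cast_zero, mul_zero, neg_zero, hurwitzZetaEven_apply_zero, if_neg h0]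
  | succ m =>
    rw [← hurwitzZetaEven_neg_two_mul_nat_add_one ((1 / 2 : ℝ) : UnitAddCircle) m]
    push_cast
    ring_nf

theorem halfTailZeta_neg_two_mul (m : ℕ) :
    halfTailZeta (-(2 * m)) = -(1 / 4) ^ m := by
  rw [halfTailZeta, hurwitzZeta_half_neg_two_mul, neg_neg, zero_sub,
    show (2 * m : ℂ) = ((2 * m : ℕ) : ℂ) by push_cast; ring, Complex.cpow_natCast, pow_mul]
  norm_num

end HalfIntegerZeta

section LamZeta

/-- The `k`-th term in the binomial expansion of `2^{s/2} ∑_{n ≥ 1} λ_n^{-s}`. -/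
noncomputable def lamZetaTerm (s : ℂ) (k : ℕ) : ℂ :=
  Ring.choose (-s / 2) k * (9 / 32) ^ k * halfTailZeta (s + 2 * k)

/-- The meromorphic continuation of `∑ λ_n^{-s}`. -/
noncomputable def lamZeta (s : ℂ) : ℂ :=
  (lam 0 : ℂ) ^ (-s) + ((2 : ℝ) : ℂ) ^ (-s / 2) * ∑' k, lamZetaTerm s k

theorem differentiableAt_lamZetaTerm {s : ℂ} {k : ℕ} (h : s + 2 * k ≠ 1) :
    DifferentiableAt ℂ (fun s => lamZetaTerm s k) s := by
  have h1 : DifferentiableAt ℂ (fun s : ℂ => Ring.choose (-s / 2) k) s :=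
    (Ring.differentiable_choose k _).comp s (by fun_prop : DifferentiableAt ℂ (fun s => -s / 2) s)
  have h2 : DifferentiableAt ℂ (fun s : ℂ => halfTailZeta (s + 2 * k)) s :=
    DifferentiableAt.comp (g := halfTailZeta) s (differentiableAt_halfTailZeta h)
      (by fun_prop : DifferentiableAt ℂ (fun s => s + 2 * (k : ℂ)) s)
  exact (h1.mul_const _).mul h2

theorem exists_norm_lamZetaTerm_le {R : ℕ} (hR : 1 ≤ R) :
    ∃ C : ℝ, ∀ s : ℂ, ‖s‖ < 2 * R → ∀ k : ℕ, R + 1 ≤ k →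
      ‖lamZetaTerm s k‖ ≤ C * (1 / 4) ^ k := by
  obtain ⟨C, hC, hG⟩ := exists_norm_halfTailZeta_le
  refine ⟨2 ^ R * C * (2 / 3 : ℝ) ^ (-(2 * R) : ℝ), fun s hs k hk => ?_⟩
  have hre : -(2 * R : ℝ) ≤ s.re := by
    linarith [neg_abs_le s.re, Complex.abs_re_le_norm s]
  have hk' : (R : ℝ) + 1 ≤ k := by exact_mod_cast hk
  have hrek : (s + 2 * k).re = s.re + 2 * k := by simp
  have h1 : ‖Ring.choose (-s / 2) k‖ ≤ 2 ^ (R + k) :=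
    Ring.norm_choose_le hR (by rw [norm_div, norm_neg, Complex.norm_ofNat]; linarith) k
  have h2 : ‖halfTailZeta (s + 2 * k)‖ ≤ C * ((2 / 3 : ℝ) ^ (-(2 * R) : ℝ) * (4 / 9) ^ k) := by
    refine (hG _ (by rw [hrek]; linarith)).trans ?_
    have h3 : (2 / 3 : ℝ) ^ s.re ≤ (2 / 3 : ℝ) ^ (-(2 * R) : ℝ) :=
      Real.rpow_le_rpow_of_exponent_ge (by norm_num) (by norm_num) hre
    have h4 : (2 / 3 : ℝ) ^ (2 * k : ℝ) = (4 / 9) ^ k := by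
      rw [show (2 * k : ℝ) = ((2 * k : ℕ) : ℝ) by push_cast; rfl, Real.rpow_natCast, pow_mul]
      norm_num
    rw [hrek, Real.rpow_add (by norm_num), h4]
    gcongr
  calc ‖lamZetaTerm s k‖
      = ‖Ring.choose (-s / 2) k‖ * (9 / 32) ^ k * ‖halfTailZeta (s + 2 * k)‖ := by
        simp [lamZetaTerm]
    _ ≤ 2 ^ (R + k) * (9 / 32) ^ k * (C * ((2 / 3 : ℝ) ^ (-(2 * R) : ℝ) * (4 / 9) ^ k)) := by
        gcongr
    _ = 2 ^ R * C * (2 / 3 : ℝ) ^ (-(2 * R) : ℝ) * (2 * (9 / 32) * (4 / 9)) ^ k := by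
        rw [mul_pow, mul_pow]
        ring
    _ = _ := by norm_num

theorem exists_eventually_tsum_lamZetaTerm_eq (s₀ : ℂ) :
    ∃ K₀ : ℕ, ∀ K ≥ K₀, ∃ T : ℂ → ℂ, DifferentiableAt ℂ T s₀ ∧
      ∀ᶠ s in 𝓝 s₀, ∑' k, lamZetaTerm s k = ∑ k ∈ Finset.range K, lamZetaTerm s k + T s := by
  obtain ⟨R, hR⟩ := exists_nat_gt ‖s₀‖
  have hR0 : (0 : ℝ) < R := (norm_nonneg _).trans_lt hR
  have hR1 : 1 ≤ R := by exact_mod_cast hR0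
  obtain ⟨C, hC⟩ := exists_norm_lamZetaTerm_le hR1
  refine ⟨R + 1, fun K hK => ⟨fun s => ∑' k, lamZetaTerm s (k + K), ?_, ?_⟩⟩
  all_goals
    have hU : Metric.ball (0 : ℂ) (2 * R) ∈ 𝓝 s₀ :=
      Metric.isOpen_ball.mem_nhds (by rw [mem_ball_zero_iff]; linarith)
    have hsum : Summable fun k => C * (1 / 4 : ℝ) ^ (k + K) :=
      ((summable_nat_add_iff K).mpr
        (summable_geometric_of_lt_one (by norm_num) (by norm_num))).mul_left C
    have hle (k : ℕ) (s : ℂ) (hs : s ∈ Metric.ball (0 : ℂ) (2 * R)) :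
        ‖lamZetaTerm s (k + K)‖ ≤ C * (1 / 4 : ℝ) ^ (k + K) :=
      hC s (by simpa using hs) _ (by omega)
  · refine (Complex.differentiableOn_tsum_of_summable_norm hsum (fun k s hs => ?_)
      Metric.isOpen_ball hle).differentiableAt hU
    refine (differentiableAt_lamZetaTerm fun h => ?_).differentiableWithinAt
    have h1 := congrArg Complex.re h
    have h2 : (R : ℝ) + 1 ≤ (k + K : ℕ) := by exact_mod_cast (by omega : R + 1 ≤ k + K)
    have h3 : ‖s‖ < 2 * R := by simpa using hs
    have h4 : (s + 2 * (k + K : ℕ)).re = s.re + 2 * (k + K : ℕ) := by simp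
    rw [h4, Complex.one_re] at h1
    linarith [neg_abs_le s.re, Complex.abs_re_le_norm s]
  · filter_upwards [hU] with s hs
    exact (Summable.of_norm_bounded hsum fun k => hle k s hs).sum_add_tsum_nat_add'.symm

theorem lam_pos (n : ℕ) : 0 < lam n := by
  unfold lam
  positivity

theorem lam_sq (n : ℕ) : lam n ^ 2 = (8 * (2 * n + 1) ^ 2 + 9) / 16 := by
  rw [lam, div_pow, Real.sq_sqrt (by positivity)]
  norm_num

theorem differentiable_lam_cpow_neg : Differentiable ℂ fun s : ℂ => (lam 0 : ℂ) ^ (-s) :=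
  fun _ => (differentiableAt_id.neg).const_cpow
    (Or.inl (Complex.ofReal_ne_zero.mpr (lam_pos 0).ne'))

theorem differentiable_two_cpow_neg_div_two :
    Differentiable ℂ fun s : ℂ => ((2 : ℝ) : ℂ) ^ (-s / 2) :=
  fun s => (by fun_prop : DifferentiableAt ℂ (fun s : ℂ => -s / 2) s).const_cpow
    (Or.inl (by norm_num))

theorem differentiableAt_lamZeta {s : ℂ} (hs : ∀ l : ℕ, s ≠ 1 - (2 * l : ℂ)) :
    DifferentiableAt ℂ lamZeta s := by
  obtain ⟨K, hK⟩ := exists_eventually_tsum_lamZetaTerm_eq s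
  obtain ⟨T, hT, heq⟩ := hK K le_rfl
  have hsum : DifferentiableAt ℂ (fun s => ∑' k, lamZetaTerm s k) s := by
    refine DifferentiableAt.congr_of_eventuallyEq (.add (.fun_sum fun k _ => ?_) hT) heq
    exact differentiableAt_lamZetaTerm fun h => hs k (eq_sub_of_add_eq h)
  exact (differentiable_lam_cpow_neg s).add ((differentiable_two_cpow_neg_div_two s).mul hsum)

theorem two_cpow_neg_pole_div_two (l : ℕ) :
    ((2 : ℝ) : ℂ) ^ (-(1 - 2 * l : ℂ) / 2) = 1 / (Real.sqrt 2 : ℂ) * 2 ^ l := by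
  rw [show -(1 - 2 * l : ℂ) / 2 = ((-(1 / 2) : ℝ) : ℂ) + (l : ℂ) by push_cast; ring,
    Complex.cpow_add _ _ (by norm_num), Complex.cpow_natCast, ← Complex.ofReal_cpow (by norm_num),
    Real.rpow_neg (by norm_num), ← Real.sqrt_eq_rpow]
  push_cast
  rw [one_div]

theorem lamZeta_residue (l : ℕ) :
    Tendsto (fun s : ℂ => (s - (1 - (2 * l : ℂ))) * lamZeta s) (𝓝[≠] (1 - (2 * l : ℂ)))
      (𝓝 ((1 / (Real.sqrt 2 : ℂ)) * (Nat.choose (2 * l) l : ℂ) * ((9 : ℂ) / 64) ^ l)) := by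
  set s₀ : ℂ := 1 - 2 * l with hs₀
  obtain ⟨K₀, hK₀⟩ := exists_eventually_tsum_lamZetaTerm_eq s₀
  obtain ⟨T, hT, heq⟩ := hK₀ (max K₀ (l + 1)) (le_max_left _ _)
  set I := Finset.range (max K₀ (l + 1))
  have hl : l ∈ I := by simp [I]
  have hrest : DifferentiableAt ℂ (fun s => (s - s₀) * ((lam 0 : ℂ) ^ (-s) +
      ((2 : ℝ) : ℂ) ^ (-s / 2) * (∑ k ∈ I.erase l, lamZetaTerm s k + T s))) s₀ := by
    refine .mul (by fun_prop) ((differentiable_lam_cpow_neg s₀).add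
      ((differentiable_two_cpow_neg_div_two s₀).mul (.add (.fun_sum fun k hk => ?_) hT)))
    refine differentiableAt_lamZetaTerm fun h => Finset.ne_of_mem_erase hk ?_
    have : (k : ℂ) = l := by linear_combination h / 2 - hs₀ / 2
    exact_mod_cast this
  have hshift : Tendsto (fun s : ℂ => s + 2 * l) (𝓝[≠] s₀) (𝓝[≠] 1) := by
    refine tendsto_nhdsWithin_iff.mpr ⟨?_, ?_⟩
    · have : Tendsto (fun s : ℂ => s + 2 * l) (𝓝 s₀) (𝓝 (s₀ + 2 * l)) :=
        (continuous_id.add continuous_const).tendsto _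
      rw [hs₀, sub_add_cancel] at this
      exact this.mono_left nhdsWithin_le_nhds
    · filter_upwards [self_mem_nhdsWithin] with s hs h
      exact hs (eq_sub_of_add_eq h)
  have hcoef : ContinuousAt (fun s : ℂ =>
      ((2 : ℝ) : ℂ) ^ (-s / 2) * (Ring.choose (-s / 2) l * (9 / 32) ^ l)) s₀ :=
    (differentiable_two_cpow_neg_div_two.continuous.mul
      (((Ring.differentiable_choose l).continuous.comp (by fun_prop)).mul
        continuous_const)).continuousAt
  have hlim := (hcoef.tendsto.mono_left nhdsWithin_le_nhds).mul
    (halfTailZeta_residue_one.comp hshift) |>.add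
      (hrest.continuousAt.tendsto.mono_left nhdsWithin_le_nhds)
  have hval : (1 / (Real.sqrt 2 : ℂ)) * (Nat.choose (2 * l) l : ℂ) * ((9 : ℂ) / 64) ^ l =
      ((2 : ℝ) : ℂ) ^ (-s₀ / 2) * (Ring.choose (-s₀ / 2) l * (9 / 32) ^ l) * 1 +
        (s₀ - s₀) * ((lam 0 : ℂ) ^ (-s₀) +
      ((2 : ℝ) : ℂ) ^ (-s₀ / 2) * (∑ k ∈ I.erase l, lamZetaTerm s₀ k + T s₀)) := by
    rw [sub_self, zero_mul, add_zero, mul_one, two_cpow_neg_pole_div_two,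
      show -s₀ / 2 = l - 1 / 2 by rw [hs₀]; ring, Ring.choose_sub_half,
      show (9 / 64 : ℂ) = 2 * (9 / 32) / 4 by norm_num, div_pow, mul_pow]
    ring
  rw [hval]
  refine hlim.congr' ?_
  filter_upwards [heq.filter_mono nhdsWithin_le_nhds] with s hs
  rw [lamZeta, hs, ← Finset.add_sum_erase I _ hl, Function.comp_apply]
  conv_rhs => rw [lamZetaTerm]
  rw [hs₀]
  ring

theorem lamZeta_neg_two_mul (l : ℕ) : lamZeta (-(2 * l : ℂ)) = 0 := by
  have hterm (k : ℕ) : lamZetaTerm (-(2 * l : ℂ)) k =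
      (l.choose k : ℂ) * (9 / 32) ^ k * halfTailZeta (-(2 * l) + 2 * k) := by
    rw [lamZetaTerm, show -(-(2 * l : ℂ)) / 2 = l by ring, Ring.choose_natCast]
  have htsum : ∑' k, lamZetaTerm (-(2 * l : ℂ)) k = -(9 / 32 + 1 / 4) ^ l := by
    rw [tsum_eq_sum (s := Finset.range (l + 1)), add_pow, ← Finset.sum_neg_distrib]
    · refine Finset.sum_congr rfl fun k hk => ?_
      have hkl : k ≤ l := by simpa [Nat.lt_succ_iff] using hk
      rw [hterm, show -(2 * l : ℂ) + 2 * k = -(2 * ((l - k : ℕ) : ℂ)) by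
        rw [Nat.cast_sub hkl]; ring, halfTailZeta_neg_two_mul]
      ring
    · intro k hk
      rw [hterm, Nat.choose_eq_zero_of_lt (by simpa using hk)]
      simp
  have hlam : (lam 0 : ℂ) ^ 2 = 17 / 16 := by
    rw [← Complex.ofReal_pow, lam_sq]
    norm_num
  rw [lamZeta, htsum, neg_neg, show (2 * l : ℂ) = ((2 * l : ℕ) : ℂ) by push_cast; ring,
    Complex.cpow_natCast, pow_mul, hlam, Nat.cast_mul, Nat.cast_ofNat,
    mul_div_cancel_left₀ _ (two_ne_zero' ℂ), Complex.cpow_natCast, mul_neg, ← mul_pow]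
  norm_num

theorem hasSum_lam_succ_cpow_neg (s : ℂ) (n : ℕ) :
    HasSum (fun k : ℕ => ((2 : ℝ) : ℂ) ^ (-s / 2) * (Ring.choose (-s / 2) k * (9 / 32) ^ k *
      ((n + 3 / 2 : ℝ) : ℂ) ^ (-(s + 2 * k)))) ((lam (n + 1) : ℂ) ^ (-s)) := by
  set x : ℝ := n + 3 / 2 with hx
  have hx1 : 3 / 2 ≤ x := by simp [hx]
  have hx0 : 0 < x := by linarith
  have hxc : (x : ℂ) ≠ 0 := Complex.ofReal_ne_zero.mpr hx0.ne'
  have hsq (r : ℝ) (hr : 0 < r) : (r : ℂ) ^ (-s) = ((r ^ 2 : ℝ) : ℂ) ^ (-s / 2) := by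
    rw [sq, Complex.ofReal_mul, Complex.mul_cpow_ofReal_nonneg hr.le hr.le,
      ← Complex.cpow_add _ _ (Complex.ofReal_ne_zero.mpr hr.ne')]
    ring_nf
  have hy : (9 / 32) / x ^ 2 < 1 := by
    rw [div_lt_one (by positivity)]
    nlinarith
  have hlam : lam (n + 1) ^ 2 = 2 * (x ^ 2 * (1 + (9 / 32) / x ^ 2)) := by
    rw [mul_add, mul_div_cancel₀ _ (by positivity), lam_sq, hx]
    push_cast
    ring
  clear_value x
  have hbin := (Complex.hasSum_choose_mul_pow (-s / 2) (y := (((9 / 32) / x ^ 2 : ℝ) : ℂ))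
    (by rwa [Complex.norm_real, Real.norm_of_nonneg (by positivity)])).mul_left
      (((2 : ℝ) : ℂ) ^ (-s / 2) * (x : ℂ) ^ (-s))
  convert! hbin using 1
  · ext k
    rw [neg_add, Complex.cpow_add _ _ hxc, Complex.cpow_neg (x : ℂ) (2 * k),
      show (2 * k : ℂ) = ((2 * k : ℕ) : ℂ) by push_cast; ring, Complex.cpow_natCast, pow_mul]
    push_cast
    rw [div_pow _ ((x : ℂ) ^ 2)]
    ring
  · rw [hsq _ (lam_pos _), hlam, Complex.ofReal_mul, Complex.mul_cpow_ofReal_nonneg (by norm_num)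
      (by positivity), Complex.ofReal_mul, Complex.mul_cpow_ofReal_nonneg (by positivity)
      (by positivity), ← hsq x hx0, Complex.ofReal_add, Complex.ofReal_one, mul_assoc]

/-- The terms of the double series obtained by expanding each `λ_{n+1}^{-s}`. -/
noncomputable def lamDoubleTerm (s : ℂ) (p : ℕ × ℕ) : ℂ :=
  ((2 : ℝ) : ℂ) ^ (-s / 2) * (Ring.choose (-s / 2) p.2 * (9 / 32) ^ p.2 *
    ((p.1 + 3 / 2 : ℝ) : ℂ) ^ (-(s + 2 * p.2)))

theorem summable_lamDoubleTerm {s : ℂ} (hs : 1 < s.re) : Summable (lamDoubleTerm s) := by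
  obtain ⟨R, hR⟩ := exists_nat_gt ‖s‖
  have hR0 : (0 : ℝ) < R := (norm_nonneg _).trans_lt hR
  have hR1 : 1 ≤ R := by exact_mod_cast hR0
  have h1 : Summable fun n : ℕ => ‖((n + 3 / 2 : ℝ) : ℂ) ^ (-s)‖ :=
    (hasSum_halfTailZeta hs).summable.norm
  have h2 : Summable fun k : ℕ => (2 : ℝ) ^ R * (1 / 4) ^ k :=
    (summable_geometric_of_lt_one (by norm_num) (by norm_num)).mul_left _
  refine Summable.mul_left _ (Summable.of_norm_bounded
    (h1.mul_of_nonneg h2 (fun _ => norm_nonneg _) fun _ => by positivity) ?_)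
  rintro ⟨n, k⟩
  have hx0 : (0 : ℝ) < n + 3 / 2 := by positivity
  have hx : ((n + 3 / 2 : ℝ) ^ 2)⁻¹ ≤ 4 / 9 := by
    rw [show (4 / 9 : ℝ) = ((3 / 2) ^ 2)⁻¹ by norm_num]
    gcongr
    simp
  have hc : ‖Ring.choose (-s / 2) k‖ ≤ 2 ^ (R + k) := Ring.norm_choose_le hR1
    (by rw [norm_div, norm_neg, Complex.norm_ofNat]; linarith [norm_nonneg s]) k
  have hsplit : ((n + 3 / 2 : ℝ) : ℂ) ^ (-(s + 2 * k)) =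
      ((n + 3 / 2 : ℝ) : ℂ) ^ (-s) * (((n + 3 / 2 : ℝ) : ℂ) ^ 2)⁻¹ ^ k := by
    rw [neg_add, Complex.cpow_add _ _ (Complex.ofReal_ne_zero.mpr hx0.ne'), Complex.cpow_neg _
      (2 * k : ℂ), show (2 * k : ℂ) = ((2 * k : ℕ) : ℂ) by push_cast; ring,
      Complex.cpow_natCast, pow_mul, inv_pow]
  change ‖Ring.choose (-s / 2) k * (9 / 32) ^ k * ((n + 3 / 2 : ℝ) : ℂ) ^ (-(s + 2 * k))‖ ≤
    ‖((n + 3 / 2 : ℝ) : ℂ) ^ (-s)‖ * (2 ^ R * (1 / 4) ^ k)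
  rw [hsplit, norm_mul, norm_mul, norm_mul, norm_pow, norm_pow, norm_inv, norm_pow,
    Complex.norm_real, Real.norm_of_nonneg hx0.le]
  calc _ ≤ 2 ^ (R + k) * ‖(9 / 32 : ℂ)‖ ^ k *
        (‖((n + 3 / 2 : ℝ) : ℂ) ^ (-s)‖ * (4 / 9) ^ k) := by gcongr
    _ = ‖((n + 3 / 2 : ℝ) : ℂ) ^ (-s)‖ * (2 ^ R * (2 * (9 / 32) * (4 / 9)) ^ k) := by
      rw [mul_pow, mul_pow, pow_add, norm_div, Complex.norm_ofNat, Complex.norm_ofNat]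
      ring
    _ = _ := by norm_num

theorem lamZeta_eq_tsum {s : ℂ} (hs : 1 < s.re) :
    lamZeta s = ∑' n : ℕ, (lam n : ℂ) ^ (-s) := by
  have hf := summable_lamDoubleTerm hs
  have hlam : HasSum (fun n : ℕ => (lam (n + 1) : ℂ) ^ (-s)) (∑' p, lamDoubleTerm s p) :=
    hf.hasSum.prod_fiberwise fun n => hasSum_lam_succ_cpow_neg s n
  have hterm (k : ℕ) :
      ∑' n, lamDoubleTerm s (n, k) = ((2 : ℝ) : ℂ) ^ (-s / 2) * lamZetaTerm s k := by
    have hw : 1 < (s + 2 * k).re := by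
      simp only [Complex.add_re, Complex.mul_re, Complex.re_ofNat, Complex.natCast_re,
        Complex.im_ofNat, Complex.natCast_im, mul_zero, sub_zero]
      linarith [(Nat.cast_nonneg k : (0 : ℝ) ≤ k)]
    simp only [lamDoubleTerm]
    rw [lamZetaTerm, ← (hasSum_halfTailZeta hw).tsum_eq, ← tsum_mul_left, ← tsum_mul_left]
  have hcomm : ∑' p, lamDoubleTerm s p = ((2 : ℝ) : ℂ) ^ (-s / 2) * ∑' k, lamZetaTerm s k := by
    rw [← tsum_mul_left, ← tsum_congr hterm, hf.tsum_prod]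
    exact (Summable.tsum_comm (f := fun n k => lamDoubleTerm s (n, k)) hf).symm
  have hsum : Summable fun n : ℕ => (lam n : ℂ) ^ (-s) :=
    (summable_nat_add_iff (f := fun n : ℕ => (lam n : ℂ) ^ (-s)) 1).mp hlam.summable
  rw [hsum.tsum_eq_zero_add, hlam.tsum_eq, hcomm, lamZeta]

end LamZeta

/-- Meromorphic continuation of the Dirichlet series `∑ λ_n^{-s}`: holomorphic away from the
points `1 - 2l` (`l ∈ ℕ`), agreeing with the series for `Re s > 1`, with at most simple poles
at `s = 1 - 2l` with residue `(1/√2)·C(2l,l)·(9/64)^l`, and vanishing at all nonpositive even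
integers. -/
theorem zeta_lambda_continuation :
    ∃ Z : ℂ → ℂ,
      (∀ s : ℂ, (∀ l : ℕ, s ≠ 1 - (2 * l : ℂ)) → DifferentiableAt ℂ Z s) ∧
      (∀ s : ℂ, 1 < s.re → Z s = ∑' n : ℕ, ((lam n : ℝ) : ℂ) ^ (-s)) ∧
      (∀ l : ℕ,
        Tendsto (fun s : ℂ => (s - (1 - (2 * l : ℂ))) * Z s) (𝓝[≠] (1 - (2 * l : ℂ)))
          (𝓝 ((1 / (Real.sqrt 2 : ℂ)) * (Nat.choose (2 * l) l : ℂ) * ((9 : ℂ) / 64) ^ l))) ∧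
      (∀ l : ℕ, Z (-(2 * l : ℂ)) = 0) := by
  exact ⟨lamZeta, fun s hs => differentiableAt_lamZeta hs, fun s hs => lamZeta_eq_tsum hs,
    lamZeta_residue, lamZeta_neg_two_mul⟩
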